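/- arXiv:1012.0674 — 3 statements merged into one kernel-verified Lean document; each statement's English description precedes it below -/
import Mathlib

section
/- Odd–even transposition sort sorts N elements in N rounds: let (α, ≤) be a linear order, N ≥ 1, and a : Fin N → α. For each parity ε ∈ {0,1}, define a sequence of arrays by a⁽⁰⁾ = a and, for t ≥ 0, a⁽ᵗ⁺¹⁾ obtained from a⁽ᵗ⁾ by simultaneously replacing, for every index i with 0 ≤ i < N − 1 and i ≡ t + ε (mod 2), the pair (a⁽ᵗ⁾(i), a⁽ᵗ⁾(i+1)) by (min(a⁽ᵗ⁾(i), a⁽ᵗ⁾(i+1)), max(a⁽ᵗ⁾(i), a⁽ᵗ⁾(i+1))), and leaving all other entries unchanged. Then a⁽ᴺ⁾ is monotone nondecreasing, and a⁽ᴺ⁾ is a permutation (rearrangement) of a. -/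
/-- One round of odd–even transposition sort with parity `p`: every adjacent
pair `(i, i+1)` with `i < N - 1` and `i ≡ p (mod 2)` is simultaneously
compare-exchanged (the minimum goes to position `i`, the maximum to position
`i+1`); all other entries are unchanged. -/
def oeStep {α : Type*} [LinearOrder α] {N : ℕ} (p : ℕ) (a : Fin N → α) :
    Fin N → α := fun i =>
  if h : i.val % 2 = p % 2 ∧ i.val + 1 < N then
    min (a i) (a ⟨i.val + 1, h.2⟩)
  else if i.val % 2 ≠ p % 2 ∧ 0 < i.val then
    max (a ⟨i.val - 1, Nat.lt_of_le_of_lt (Nat.sub_le _ _) i.isLt⟩) (a i)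
  else a i

/-- The array after `t` rounds of odd–even transposition sort started with
parity `ε`: `a⁽⁰⁾ = a` and `a⁽ᵗ⁺¹⁾` is obtained from `a⁽ᵗ⁾` by
compare-exchanging all adjacent pairs `(i, i+1)` with `i ≡ t + ε (mod 2)`. -/
def oeSort {α : Type*} [LinearOrder α] {N : ℕ} (ε : ℕ) (a : Fin N → α) :
    ℕ → (Fin N → α)
  | 0 => a
  | t + 1 => oeStep (t + ε) (oeSort ε a t)

/-- Suffix sums of `f` over positions `m ≤ i < N`. -/
def oeSuf (N : ℕ) (f : ℕ → ℕ) (m : ℕ) : ℕ := ∑ i ∈ Finset.Ico m N, f i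

lemma oeSuf_succ {N : ℕ} (f : ℕ → ℕ) {m : ℕ} (h : m < N) :
    oeSuf N f m = f m + oeSuf N f (m + 1) :=
  Finset.sum_eq_sum_Ico_succ_bot h f

lemma oeSuf_ge {N : ℕ} (f : ℕ → ℕ) {m : ℕ} (h : N ≤ m) : oeSuf N f m = 0 := by
  simp [oeSuf, Finset.Ico_eq_empty_of_le h]

/-- `f'` arises from `f` by one round of parity `p`. -/
structure OeRound (N p : ℕ) (f f' : ℕ → ℕ) : Prop where
  lo : ∀ i, i % 2 = p % 2 → i + 1 < N → f' i = min (f i) (f (i + 1))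
  hi : ∀ i, i % 2 = p % 2 → i + 1 < N → f' (i + 1) = max (f i) (f (i + 1))
  last : ∀ i, i % 2 = p % 2 → i + 1 = N → f' i = f i
  first : p % 2 = 1 → f' 0 = f 0

lemma oeSuf_inactive {N p : ℕ} {f f' : ℕ → ℕ} (h : OeRound N p f f') :
    ∀ d m, N ≤ m + d → (m = 0 ∨ m % 2 = p % 2) → oeSuf N f' m = oeSuf N f m := by
  intro d
  induction d using Nat.strong_induction_on with
  | _ d ih =>
    intro m hd hm
    by_cases hmN : N ≤ m
    · rw [oeSuf_ge _ hmN, oeSuf_ge _ hmN]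
    · by_cases hp : m % 2 = p % 2
      · by_cases h1 : m + 1 < N
        · have := ih (d - 2) (by omega) (m + 1 + 1) (by omega) (by omega)
          rw [oeSuf_succ f' (by omega), oeSuf_succ f' h1, oeSuf_succ f (by omega),
            oeSuf_succ f h1, this, h.lo m hp h1, h.hi m hp h1]
          omega
        · rw [oeSuf_succ f' (by omega), oeSuf_succ f (by omega), h.last m hp (by omega),
            oeSuf_ge _ (by omega), oeSuf_ge _ (by omega)]
      · have hm0 : m = 0 := by omega
        subst hm0
        have := ih (d - 1) (by omega) (0 + 1) (by omega) (by omega)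
        rw [oeSuf_succ f' (by omega), oeSuf_succ f (by omega), this, h.first (by omega)]

lemma oeSuf_active {N p : ℕ} {f f' : ℕ → ℕ} (h : OeRound N p f f')
    {i : ℕ} (hi : i % 2 = p % 2) (hN : i + 1 < N) :
    oeSuf N f' (i + 1) = max (f i) (f (i + 1)) + oeSuf N f (i + 1 + 1) := by
  rw [oeSuf_succ f' hN, h.hi i hi hN, oeSuf_inactive h N _ (by omega) (by omega)]

lemma oeSuf_mono {N p : ℕ} {f f' : ℕ → ℕ} (h : OeRound N p f f') (m : ℕ) :
    oeSuf N f m ≤ oeSuf N f' m := by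
  by_cases hm : m = 0 ∨ m % 2 = p % 2
  · exact (oeSuf_inactive h N m (by omega) hm).ge
  · obtain ⟨i, rfl⟩ : ∃ i, m = i + 1 := ⟨m - 1, by omega⟩
    by_cases hN : i + 1 < N
    · rw [oeSuf_active h (by omega) hN, oeSuf_succ f hN]
      omega
    · rw [oeSuf_ge _ (by omega)]
      omega

lemma oeSuf_total {N : ℕ} {f : ℕ → ℕ} (hf : ∀ i, f i ≤ 1) :
    ∀ m, oeSuf N f 0 ≤ m + oeSuf N f m := by
  intro m
  induction m with
  | zero => omega
  | succ m ih =>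
    by_cases hN : m < N
    · have := oeSuf_succ f hN
      have := hf m
      omega
    · rw [oeSuf_ge f (m := m) (by omega)] at ih
      omega

lemma oeSuf_le {N : ℕ} {f : ℕ → ℕ} (hf : ∀ i, f i ≤ 1) :
    ∀ d m, N ≤ m + d → oeSuf N f m ≤ d := by
  intro d
  induction d with
  | zero => intro m hm; rw [oeSuf_ge f (by omega)]
  | succ d ih =>
    intro m hm
    by_cases hN : m < N
    · have := oeSuf_succ f hN
      have := hf m
      have := ih (m + 1) (by omega)
      omega
    · rw [oeSuf_ge f (by omega)]
      omega

lemma oeSuf_anti {N : ℕ} (f : ℕ → ℕ) {m n : ℕ} (h : m ≤ n) :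
    oeSuf N f n ≤ oeSuf N f m :=
  Finset.sum_le_sum_of_subset (Finset.Ico_subset_Ico_left h)

/-- The key invariant: the `j`-th one from the right has advanced far enough. -/
lemma oe_invariant {N ε : ℕ} {F : ℕ → ℕ → ℕ} (hF : ∀ t i, F t i ≤ 1)
    (hR : ∀ t, OeRound N (t + ε) (F t) (F (t + 1))) {k δ : ℕ}
    (hk : oeSuf N (F 0) 0 = k) (hδ : δ ≤ 1) (hpar : (k + δ) % 2 = ε % 2) :
    ∀ t, oeSuf N (F t) 0 = k ∧ ∀ j m, j ≤ k → m + j ≤ N → m + 2 * j ≤ k + δ + t →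
      j ≤ oeSuf N (F t) m := by
  intro t
  induction t with
  | zero =>
    refine ⟨hk, fun j m hj h1 h2 => ?_⟩
    have := oeSuf_total (N := N) (hF 0) m
    omega
  | succ t ih =>
    obtain ⟨ih0, ih⟩ := ih
    have h0 : oeSuf N (F (t + 1)) 0 = k := by
      rw [oeSuf_inactive (hR t) N 0 (by omega) (by omega), ih0]
    refine ⟨h0, fun j m hj h1 h2 => ?_⟩
    by_cases hb : m + 2 * j ≤ k + δ + t
    · exact (ih j m hj h1 hb).trans (oeSuf_mono (hR t) m)
    · rcases Nat.eq_zero_or_pos j with rfl | hj0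
      · omega
      rcases Nat.eq_zero_or_pos m with rfl | hm0
      · omega
      obtain ⟨i, rfl⟩ : ∃ i, m = i + 1 := ⟨m - 1, by omega⟩
      have hN : i + 1 < N ∨ i + 1 = N := by omega
      rcases hN with hN | hN
      · rw [oeSuf_active (hR t) (by omega) hN]
        have e1 := ih j i hj (by omega) (by omega)
        have e2 := ih (j - 1) (i + 1 + 1) (by omega) (by omega) (by omega)
        have e3 := oeSuf_succ (F t) (m := i) (N := N) (by omega)
        have e4 := oeSuf_succ (F t) hN
        have e5 := hF t i
        have e6 := hF t (i + 1)
        omega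
      · omega

/-- Zero-one indicator of entries at least `c`. -/
def oeInd {α : Type*} [LinearOrder α] {N : ℕ} (c : α) (a : Fin N → α) (i : ℕ) : ℕ :=
  if h : i < N then (if c ≤ a ⟨i, h⟩ then 1 else 0) else 0

lemma oeInd_le {α : Type*} [LinearOrder α] {N : ℕ} (c : α) (a : Fin N → α) (i : ℕ) :
    oeInd c a i ≤ 1 := by
  unfold oeInd; split_ifs <;> omega

lemma oeStep_round {α : Type*} [LinearOrder α] {N : ℕ} (c : α) (p : ℕ) (a : Fin N → α) :
    OeRound N p (oeInd c a) (oeInd c (oeStep p a)) where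
  lo i hi hN := by
    have h : i < N := by omega
    have e : oeStep p a ⟨i, h⟩ = min (a ⟨i, h⟩) (a ⟨i + 1, hN⟩) := by
      simp [oeStep, hi, hN]
    simp only [oeInd, h, hN, dif_pos, e, le_min_iff]
    split_ifs <;> simp_all
  hi i hi hN := by
    have h : i < N := by omega
    have e : oeStep p a ⟨i + 1, hN⟩ = max (a ⟨i, h⟩) (a ⟨i + 1, hN⟩) := by
      have h2 : (i + 1) % 2 ≠ p % 2 := by omega
      simp [oeStep, h2]
    simp only [oeInd, h, hN, dif_pos, e, le_max_iff]
    split_ifs <;> simp_all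
  last i hi hN := by
    have h : i < N := by omega
    have h2 : ¬ (i + 1 < N) := by omega
    have e : oeStep p a ⟨i, h⟩ = a ⟨i, h⟩ := by
      simp [oeStep, hi, h2]
    simp only [oeInd, e]
  first hp := by
    by_cases h : 0 < N
    · have e : oeStep p a ⟨0, h⟩ = a ⟨0, h⟩ := by
        simp [oeStep, hp]
      simp only [oeInd, e]
    · simp [oeInd, h]

/-- The index exchange performed by one round. -/
def oeSwap {α : Type*} [LinearOrder α] {N : ℕ} (p : ℕ) (a : Fin N → α) (i : Fin N) : Fin N :=
  if h : i.val % 2 = p % 2 ∧ i.val + 1 < N then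
    (if a i ≤ a ⟨i.val + 1, h.2⟩ then i else ⟨i.val + 1, h.2⟩)
  else if i.val % 2 ≠ p % 2 ∧ 0 < i.val then
    (if a ⟨i.val - 1, Nat.lt_of_le_of_lt (Nat.sub_le _ _) i.isLt⟩ ≤ a i then i
      else ⟨i.val - 1, Nat.lt_of_le_of_lt (Nat.sub_le _ _) i.isLt⟩)
  else i

lemma oeSwap_spec {α : Type*} [LinearOrder α] {N : ℕ} (p : ℕ) (a : Fin N → α) (i : Fin N) :
    oeStep p a i = a (oeSwap p a i) := by
  unfold oeStep oeSwap
  split_ifs with h1 h2 h3 h4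
  · exact min_eq_left h2
  · exact min_eq_right (le_of_not_ge h2)
  · exact max_eq_right h4
  · exact max_eq_left (le_of_not_ge h4)
  · rfl

lemma oeSwap_invol {α : Type*} [LinearOrder α] {N : ℕ} (p : ℕ) (a : Fin N → α) :
    Function.Involutive (oeSwap p a) := by
  rintro ⟨i, hi⟩
  by_cases h1 : i % 2 = p % 2 ∧ i + 1 < N
  · have h2 : (i + 1) % 2 ≠ p % 2 := by omega
    by_cases h : a ⟨i, hi⟩ ≤ a ⟨i + 1, h1.2⟩
    · have e : oeSwap p a ⟨i, hi⟩ = ⟨i, hi⟩ := by simp [oeSwap, h1, h]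
      rw [e, e]
    · have e : oeSwap p a ⟨i, hi⟩ = ⟨i + 1, h1.2⟩ := by simp [oeSwap, h1, h]
      rw [e]
      simp [oeSwap, h2, h]
  · by_cases h2 : i % 2 ≠ p % 2 ∧ 0 < i
    · obtain ⟨i, rfl⟩ : ∃ k, i = k + 1 := ⟨i - 1, by omega⟩
      have h3 : i % 2 = p % 2 := by omega
      by_cases h : a ⟨i, by omega⟩ ≤ a ⟨i + 1, hi⟩
      · have e : oeSwap p a ⟨i + 1, hi⟩ = ⟨i + 1, hi⟩ := by simp [oeSwap, h2, h]
        rw [e, e]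
      · have e : oeSwap p a ⟨i + 1, hi⟩ = ⟨i, by omega⟩ := by simp [oeSwap, h2, h]
        rw [e]
        simp [oeSwap, h3, h, hi]
    · have e : oeSwap p a ⟨i, hi⟩ = ⟨i, hi⟩ := by
        unfold oeSwap
        rw [dif_neg h1, if_neg h2]
      rw [e, e]

lemma oeSort_perm {α : Type*} [LinearOrder α] {N : ℕ} (ε : ℕ) (a : Fin N → α) (t : ℕ) :
    ∃ π : Equiv.Perm (Fin N), oeSort ε a t = a ∘ π := by
  induction t with
  | zero => exact ⟨1, rfl⟩
  | succ t ih =>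
    obtain ⟨π, hπ⟩ := ih
    refine ⟨((oeSwap_invol (t + ε) (oeSort ε a t)).toPerm _).trans π, ?_⟩
    funext i
    change oeStep (t + ε) (oeSort ε a t) i = a (π (oeSwap (t + ε) (oeSort ε a t) i))
    rw [oeSwap_spec]
    exact congrFun hπ _

lemma oeSort_adj {α : Type*} [LinearOrder α] {N : ℕ} (ε : ℕ) (a : Fin N → α)
    (i : ℕ) (hi : i + 1 < N) :
    oeSort ε a N ⟨i, by omega⟩ ≤ oeSort ε a N ⟨i + 1, hi⟩ := by
  by_contra hlt
  have hiN : i < N := by omega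
  set c := oeSort ε a N ⟨i, hiN⟩ with hc
  set F : ℕ → ℕ → ℕ := fun t => oeInd c (oeSort ε a t) with hFdef
  have hF : ∀ t i, F t i ≤ 1 := fun t i => oeInd_le _ _ _
  have hR : ∀ t, OeRound N (t + ε) (F t) (F (t + 1)) := fun t => oeStep_round _ _ _
  obtain ⟨k, hk⟩ : ∃ k, oeSuf N (F 0) 0 = k := ⟨_, rfl⟩
  obtain ⟨h0, hinv⟩ := oe_invariant hF hR hk (δ := (k + ε) % 2) (by omega) (by omega) N
  have f1 : F N i = 1 := by simp [hFdef, oeInd, hiN, ← hc]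
  have f2 : F N (i + 1) = 0 := by
    simp only [hFdef, oeInd, hi, dif_pos, hlt, if_false]
  have hkN : k ≤ N := by
    rw [← hk]; exact oeSuf_le (hF 0) N 0 (by omega)
  have s1 := oeSuf_succ (F N) hiN
  have s2 := oeSuf_succ (F N) hi
  by_cases hcase : N ≤ k + (i + 1)
  · have := hinv (N - (i + 1)) (i + 1) (by omega) (by omega) (by omega)
    have := oeSuf_le (N := N) (hF N) (N - (i + 2)) (i + 1 + 1) (by omega)
    omega
  · have e1 := hinv k (N - k) le_rfl (by omega) (by omega)
    have e2 := oeSuf_anti (N := N) (F N) (m := i + 1) (n := N - k) (by omega)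
    have e3 := oeSuf_anti (N := N) (F N) (m := 0) (n := i) (by omega)
    omega

/-- Odd–even transposition sort sorts `N` elements in `N` rounds: for any
linear order, any `N ≥ 1`, any array `a` of `N` elements and either starting
parity `ε ∈ {0, 1}`, after `N` rounds the array is monotone nondecreasing and
is a rearrangement (permutation) of `a`. -/
theorem odd_even_transposition_sort {α : Type*} [LinearOrder α]
    (N : ℕ) (hN : 1 ≤ N) (a : Fin N → α) (ε : ℕ) (hε : ε = 0 ∨ ε = 1) :
    Monotone (oeSort ε a N) ∧ ∃ π : Equiv.Perm (Fin N), oeSort ε a N = a ∘ π := by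
  refine ⟨?_, oeSort_perm ε a N⟩
  obtain ⟨n, rfl⟩ : ∃ n, N = n + 1 := ⟨N - 1, by omega⟩
  rw [Fin.monotone_iff_le_succ]
  intro i
  exact oeSort_adj ε a i.val (by omega)
end

section
/- The extension of the traffic rule 184 sorts lists of 1-bit numbers: consider the one-dimensional radius-1 cellular automaton with state set Q = {0, 1, q} (q quiescent) whose local rule maps a cell in state 1 to 0 if its right neighbor is in state 0 and otherwise leaves it in state 1, maps a cell in state 0 to 1 if its left neighbor is in state 1 and otherwise leaves it in state 0, and leaves a quiescent cell quiescent. Let n ≥ 1, let b : Fin n → {0,1}, and let c be the configuration with c(i) = b(i) for 0 ≤ i < n and c(i) = q otherwise. Then there exists t ∈ ℕ such that F^t c is stable (a fixed point of F) and the restriction of F^t c to cells 0,…,n−1 consists of n − m zeros followed by m ones, where m is the number of indices i with b(i) = 1. -/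
/-- The global map of a one-dimensional radius-1 cellular automaton with
local rule `f`. -/
def glob {Q : Type*} (f : Q → Q → Q → Q) (c : ℤ → Q) : ℤ → Q :=
  fun i => f (c (i - 1)) (c i) (c (i + 1))

/-- The extension of the traffic rule 184 to the state set
`Q = {0, 1, q}` (modelled as `Option Bool`, with `none` the quiescent state):
a cell in state `1` becomes `0` if its right neighbor is `0`, otherwise stays
`1`; a cell in state `0` becomes `1` if its left neighbor is `1`, otherwise
stays `0`; a quiescent cell stays quiescent. -/
def rule184 (l c r : Option Bool) : Option Bool :=
  match c with
  | none => none
  | some true => if r = some false then some false else some true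
  | some false => if l = some true then some true else some false

/-- Number of ones in the cells `0, …, k-1`. -/
def prefixOnes (c : ℤ → Option Bool) : ℕ → ℕ
  | 0 => 0
  | k + 1 => prefixOnes c k + if c (k : ℤ) = some true then 1 else 0

theorem rule184_count (x y z : Option Bool) :
    (if rule184 x y z = some true then 1 else 0) +
      (if y = some true ∧ z = some false then 1 else 0) =
    (if x = some true ∧ y = some false then 1 else 0) + (if y = some true then 1 else 0) := by
  rcases x with _ | _ | _ <;> rcases y with _ | _ | _ <;> rcases z with _ | _ | _ <;>
    simp [rule184]

theorem rule184_fix (x y z : Option Bool) (h1 : x = some true → y ≠ some false)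
    (h2 : y = some true → z ≠ some false) : rule184 x y z = y := by
  revert h1 h2
  rcases x with _ | _ | _ <;> rcases y with _ | _ | _ <;> rcases z with _ | _ | _ <;>
    simp [rule184]

theorem prefixOnes_step (c : ℤ → Option Bool) (h : c (-1) = none) (k : ℕ) :
    prefixOnes (glob rule184 c) k +
      (if c ((k : ℤ) - 1) = some true ∧ c (k : ℤ) = some false then 1 else 0)
      = prefixOnes c k := by
  induction k with
  | zero => simp [prefixOnes, h]
  | succ k ih =>
    have e : ((k + 1 : ℕ) : ℤ) - 1 = k := by push_cast; ring
    have e2 : ((k + 1 : ℕ) : ℤ) = (k : ℤ) + 1 := by push_cast; ring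
    rw [e, e2]
    simp only [prefixOnes, ← ih]
    have : (if glob rule184 c (k : ℤ) = some true then 1 else 0) + _ = _ + _ :=
      rule184_count (c ((k : ℤ) - 1)) (c (k : ℤ)) (c ((k : ℤ) + 1))
    omega

theorem glob_none_iff (c : ℤ → Option Bool) (i : ℤ) :
    glob rule184 c i = none ↔ c i = none := by
  simp only [glob, rule184]
  generalize c (i - 1) = x
  generalize c i = y
  generalize c (i + 1) = z
  rcases x with _ | _ | _ <;> rcases y with _ | _ | _ <;> rcases z with _ | _ | _ <;> simp

theorem sorted_form (c : ℤ → Option Bool) (n : ℕ)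
    (hs : ∀ k : ℕ, k + 1 < n → c (k : ℤ) = some true → c ((k : ℤ) + 1) = some true) :
    prefixOnes c n ≤ n ∧ ∀ i : ℕ, i < n → (c (i : ℤ) = some true ↔ n - prefixOnes c n ≤ i) := by
  induction n with
  | zero => simp [prefixOnes]
  | succ k ih =>
    obtain ⟨h1, h2⟩ := ih (fun j hj => hs j (by omega))
    by_cases hk : c (k : ℤ) = some true
    · simp only [prefixOnes, hk, if_true]
      refine ⟨by omega, fun i hi => ?_⟩
      rcases Nat.lt_succ_iff_lt_or_eq.mp hi with h | rfl
      · rw [h2 i h]; omega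
      · simp only [hk, true_iff]; omega
    · have h0 : prefixOnes c k = 0 := by
        rcases k with _ | j
        · rfl
        · have hj := h2 j (by omega)
          have : ¬ c (j : ℤ) = some true := fun h => hk (by
            have := hs j (by omega) h
            push_cast; exact this)
          rw [hj] at this
          omega
      simp only [prefixOnes, hk, if_false, h0]
      refine ⟨by omega, fun i hi => ?_⟩
      rcases Nat.lt_succ_iff_lt_or_eq.mp hi with h | rfl
      · rw [h2 i h, h0]; omega
      · simp only [hk, false_iff]; omega

theorem reach_sorted (n m : ℕ) : ∀ (s : ℕ) (c : ℤ → Option Bool),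
    (∑ k ∈ Finset.range n, prefixOnes c k = s) →
    (∀ i : ℤ, c i = none ↔ ¬ (0 ≤ i ∧ i < (n : ℤ))) → prefixOnes c n = m →
    ∃ t : ℕ, glob rule184 ((glob rule184)^[t] c) = (glob rule184)^[t] c ∧
      ∀ i : ℕ, i < n →
        ((glob rule184)^[t] c) (i : ℤ) = some (if i < n - m then false else true) := by
  intro s
  induction s using Nat.strong_induction_on with
  | _ s ih =>
    intro c hs hc hm
    have hneg : c (-1) = none := (hc _).2 (by omega)
    have hn : c (n : ℤ) = none := (hc _).2 (by omega)
    have hstep := prefixOnes_step c hneg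
    by_cases hp : ∃ k : ℕ, k < n ∧ c ((k : ℤ) - 1) = some true ∧ c (k : ℤ) = some false
    · obtain ⟨k, hk, h1, h2⟩ := hp
      obtain ⟨t, ht⟩ := ih (∑ k ∈ Finset.range n, prefixOnes (glob rule184 c) k) (by
          rw [← hs]
          apply Finset.sum_lt_sum
          · intro i _
            have := hstep i
            omega
          · refine ⟨k, Finset.mem_range.2 hk, ?_⟩
            have := hstep k
            rw [if_pos ⟨h1, h2⟩] at this
            omega) (glob rule184 c) rfl
          (fun i => by rw [glob_none_iff, hc])
          (by have := hstep n
              rw [if_neg (by simp [hn])] at this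
              omega)
      exact ⟨t + 1, by simpa only [Function.iterate_succ_apply] using ht⟩
    · have hno : ∀ i : ℤ, c (i - 1) = some true → c i ≠ some false := by
        intro i h1 h2
        have hi : 0 ≤ i ∧ i < (n : ℤ) := by
          by_contra h
          rw [(hc i).2 h] at h2
          simp at h2
        refine hp ⟨i.toNat, by omega, ?_⟩
        rw [Int.toNat_of_nonneg hi.1]
        exact ⟨h1, h2⟩
      refine ⟨0, ?_, ?_⟩
      · funext i
        have a1 := hno i
        have a2 := hno (i + 1)
        rw [add_sub_cancel_right] at a2
        exact rule184_fix _ _ _ a1 a2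
      · intro i hi
        have hf := (sorted_form c n (fun k hk h => by
          have a := hno (k + 1)
          rw [add_sub_cancel_right] at a
          have a := a h
          have b : c ((k : ℤ) + 1) ≠ none := fun h => (hc _).1 h (by omega)
          revert a b
          generalize c ((k : ℤ) + 1) = z
          rcases z with _ | _ | _ <;> simp)).2 i hi
        have b : c (i : ℤ) ≠ none := fun h => (hc _).1 h (by omega)
        rw [hm] at hf
        simp only [Function.iterate_zero, id]
        revert hf b
        generalize c (i : ℤ) = z
        rcases z with _ | _ | _ <;> simp <;> omega

/-- The extended traffic rule 184 sorts lists of 1-bit numbers: starting from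
the configuration holding `b : Fin n → Bool` in cells `0, …, n-1` and
quiescent elsewhere, after some number `t` of steps a stable configuration is
reached whose restriction to cells `0, …, n-1` consists of `n - m` zeros
followed by `m` ones, where `m` is the number of `1`s among the inputs. -/
theorem rule184_sorts (n : ℕ) (hn : 1 ≤ n) (b : Fin n → Bool) :
    let c : ℤ → Option Bool :=
      fun i => if h : 0 ≤ i ∧ i < (n : ℤ) then
        some (b ⟨i.toNat, by omega⟩) else none
    let m : ℕ := (Finset.univ.filter fun i => b i = true).card
    ∃ t : ℕ,
      glob rule184 ((glob rule184)^[t] c) = (glob rule184)^[t] c ∧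
      ∀ i : ℕ, i < n →
        ((glob rule184)^[t] c) (i : ℤ) = some (if i < n - m then false else true) := by
  intro c m
  refine reach_sorted n m _ c rfl (fun i => by simp [c]) ?_
  have key : ∀ k : ℕ, k ≤ n →
      prefixOnes c k = ∑ i ∈ Finset.range k, if c (i : ℤ) = some true then 1 else 0 := by
    intro k _
    induction k with
    | zero => rfl
    | succ k ih => rw [Finset.sum_range_succ, prefixOnes, ih (by omega)]
  rw [key n le_rfl, Finset.sum_range]
  simp only [m, Finset.card_filter]
  refine Finset.sum_congr rfl fun i _ => ?_
  simp [c]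
end

section
/- Correctness of sequential most-significant-bit-first compare-and-exchange: let k ≥ 1 and let u, v : Fin k → Bool be two k-bit strings (index 0 is the most significant bit). For each i, let ord(i) ∈ {lt, eq, gt} be the lexicographic comparison of the length-(i+1) prefixes (u(0),…,u(i)) and (v(0),…,v(i)). Define a, b : Fin k → Bool by a(i) = v(i) if ord(i) = gt and a(i) = u(i) otherwise, and b(i) = u(i) if ord(i) = gt and b(i) = v(i) otherwise. Then a is the lexicographically smaller of u and v and b is the lexicographically larger; equivalently, value(a) = min(value(u), value(v)) and value(b) = max(value(u), value(v)), and the pair (a, b) is a rearrangement of the pair (u, v). -/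
/-- The value of a `k`-bit string, most significant bit at index `0`:
`value u = Σ_{i<k} u i · 2^(k-1-i)`. -/
def bitValue {k : ℕ} (u : Fin k → Bool) : ℕ :=
  ∑ i : Fin k, if u i then 2 ^ (k - 1 - i.val) else 0

/-- The value of the length-`(i+1)` prefix of a `k`-bit string (most
significant bit first); comparing these values is the lexicographic
comparison of the prefixes. -/
def prefixValue {k : ℕ} (u : Fin k → Bool) (i : Fin k) : ℕ :=
  ∑ j : Fin k, if j ≤ i ∧ u j = true then 2 ^ (i.val - j.val) else 0

theorem prefixValue_succ {k : ℕ} (u : Fin k → Bool) (n : ℕ) (h : n + 1 < k) :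
    prefixValue u ⟨n + 1, h⟩ =
      2 * prefixValue u ⟨n, by omega⟩ + (u ⟨n + 1, h⟩).toNat := by
  have h1 : (u ⟨n + 1, h⟩).toNat =
      ∑ j : Fin k, if j = ⟨n + 1, h⟩ then (u j).toNat else 0 := by
    simp
  rw [h1]
  unfold prefixValue
  rw [Finset.mul_sum, ← Finset.sum_add_distrib]
  refine Finset.sum_congr rfl fun j _ => ?_
  obtain ⟨j, hj⟩ := j
  simp only [Fin.mk_le_mk, Fin.mk.injEq]
  cases hu : u ⟨j, hj⟩
  · simp
  · rcases lt_trichotomy j (n + 1) with hl | he | hg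
    · have e : n + 1 - j = (n - j) + 1 := by omega
      simp [hl.le, hl.ne, Nat.le_of_lt_succ hl, e, pow_succ, mul_comm]
    · subst he
      simp
    · simp [not_le.mpr hg, hg.ne', not_le.mpr (show n < j by omega)]

theorem prefixValue_zero {k : ℕ} (u : Fin k → Bool) (h : 0 < k) :
    prefixValue u ⟨0, h⟩ = (u ⟨0, h⟩).toNat := by
  unfold prefixValue
  rw [Finset.sum_eq_single ⟨0, h⟩]
  · cases u ⟨0, h⟩ <;> simp
  · intro j _ hj
    rw [if_neg]
    rintro ⟨hle, _⟩
    exact hj (le_antisymm hle (Nat.zero_le _))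
  · simp

theorem prefixValue_last {k : ℕ} (u : Fin k → Bool) (h : k - 1 < k) :
    prefixValue u ⟨k - 1, h⟩ = bitValue u := by
  unfold prefixValue bitValue
  refine Finset.sum_congr rfl fun j _ => ?_
  have : j ≤ ⟨k - 1, h⟩ := Nat.le_sub_one_of_lt j.isLt
  simp [this]

theorem prefixValue_lt_mono {k : ℕ} (u v : Fin k → Bool) (n : ℕ) (hn : n < k)
    (hlt : prefixValue u ⟨n, hn⟩ < prefixValue v ⟨n, hn⟩) (m : ℕ) (hnm : n ≤ m) :
    ∀ hm : m < k, prefixValue u ⟨m, hm⟩ < prefixValue v ⟨m, hm⟩ := by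
  induction m, hnm using Nat.le_induction with
  | base => intro _; exact hlt
  | succ m _ ih =>
    intro hm
    have := ih (by omega)
    rw [prefixValue_succ, prefixValue_succ]
    have := Bool.toNat_le (u ⟨m + 1, hm⟩)
    omega

theorem bitValue_lt_of_prefixValue_lt {k : ℕ} (u v : Fin k → Bool) (i : Fin k)
    (hlt : prefixValue u i < prefixValue v i) : bitValue u < bitValue v := by
  have hi := i.isLt
  have h := prefixValue_lt_mono u v i.val hi hlt (k - 1) (by omega) (by omega)
  rwa [prefixValue_last, prefixValue_last] at h

theorem bit_eq_of_prefixValue_eq {k : ℕ} (u v : Fin k → Bool) (i : Fin k)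
    (h : prefixValue u i = prefixValue v i) : u i = v i := by
  have key : (u i).toNat = (v i).toNat := by
    obtain ⟨n, hn⟩ := i
    cases n with
    | zero => rwa [prefixValue_zero, prefixValue_zero] at h
    | succ n =>
      rw [prefixValue_succ, prefixValue_succ] at h
      have := Bool.toNat_le (u ⟨n + 1, hn⟩)
      have := Bool.toNat_le (v ⟨n + 1, hn⟩)
      omega
  revert key
  cases u i <;> cases v i <;> simp

/-- Correctness of sequential most-significant-bit-first compare-and-exchange:
with `ord i` the lexicographic comparison of the length-`(i+1)` prefixes of
`u` and `v`, the strings `a` (taking `v i` where `ord i = gt`, else `u i`) and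
`b` (taking `u i` where `ord i = gt`, else `v i`) satisfy
`value a = min (value u) (value v)`, `value b = max (value u) (value v)`, and
`(a, b)` is a rearrangement of `(u, v)`. -/
theorem compare_exchange_correct (k : ℕ) (hk : 1 ≤ k) (u v : Fin k → Bool) :
    let ord : Fin k → Ordering := fun i => compare (prefixValue u i) (prefixValue v i)
    let a : Fin k → Bool := fun i => if ord i = Ordering.gt then v i else u i
    let b : Fin k → Bool := fun i => if ord i = Ordering.gt then u i else v i
    bitValue a = min (bitValue u) (bitValue v) ∧
    bitValue b = max (bitValue u) (bitValue v) ∧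
    ((a = u ∧ b = v) ∨ (a = v ∧ b = u)) := by
  intro ord a b
  have hord : ∀ i, ord i = Ordering.gt ↔ prefixValue v i < prefixValue u i := fun i =>
    compare_gt_iff_gt
  rcases le_or_gt (bitValue u) (bitValue v) with hle | hgt
  · have hn : ∀ i, ¬ ord i = Ordering.gt := fun i hi =>
      absurd (bitValue_lt_of_prefixValue_lt v u i ((hord i).1 hi)) (not_lt.mpr hle)
    have ha : a = u := funext fun i => if_neg (hn i)
    have hb : b = v := funext fun i => if_neg (hn i)
    rw [ha, hb]
    exact ⟨(min_eq_left hle).symm, (max_eq_right hle).symm, Or.inl ⟨rfl, rfl⟩⟩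
  · have hn : ∀ i, ¬ ord i = Ordering.gt → u i = v i := fun i hi => by
      rw [hord, not_lt] at hi
      refine bit_eq_of_prefixValue_eq u v i (le_antisymm hi (not_lt.mp fun hlt => ?_))
      exact absurd (bitValue_lt_of_prefixValue_lt u v i hlt) (not_lt.mpr hgt.le)
    have ha : a = v := funext fun i => by
      by_cases hi : ord i = Ordering.gt
      · exact if_pos hi
      · exact (if_neg hi).trans (hn i hi)
    have hb : b = u := funext fun i => by
      by_cases hi : ord i = Ordering.gt
      · exact if_pos hi
      · exact (if_neg hi).trans (hn i hi).symm
    rw [ha, hb]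
    exact ⟨(min_eq_right hgt.le).symm, (max_eq_left hgt.le).symm, Or.inr ⟨rfl, rfl⟩⟩
end
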